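/- arXiv:math/0703902 — 2 statements merged into one kernel-verified Lean document; each statement's English description precedes it below -/
import Mathlib

section
/- Fix a constant c > 0 and for each n let p = c/n². Then the probability under the random G(n,p)-game measure that a pure Nash equilibrium exists satisfies P_{(n,p)}[∃ PNE] = (1 − c/(8n²))^{n(n−1)/2} + o(1) as n → ∞; in particular it converges to e^{−c/16}. -/
open scoped Classical
open Finset

/-- Best-response tables of a game with `n` binary-strategy players: player `v`'s table
assigns a best response `ω v τ ∈ {0,1}` to each (masked) strategy profile `τ`.
Only the values at profiles vanishing outside the neighborhood of `v` are ever read,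
so under the uniform measure the read entries are i.i.d. uniform on `{0,1}`. -/
abbrev Tables (n : ℕ) := Fin n → (Fin n → Bool) → Bool

/-- Potential edges of a graph on `Fin n`: ordered pairs `(u,v)` with `u < v`. -/
abbrev EdgePair (n : ℕ) := {q : Fin n × Fin n // q.1 < q.2}

/-- A sample of the Erdős–Rényi graph: an indicator of presence for each potential edge. -/
abbrev GraphSeed (n : ℕ) := EdgePair n → Bool

/-- Adjacency relation of the graph determined by a graph seed. -/
def adjB {n : ℕ} (g : GraphSeed n) (u v : Fin n) : Bool :=
  if h : u < v then g ⟨(u, v), h⟩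
  else if h' : v < u then g ⟨(v, u), h'⟩
  else false

/-- Restriction of a strategy profile to the neighborhood of `v`
(strategies outside the neighborhood are replaced by `false`). -/
def maskG {n : ℕ} (g : GraphSeed n) (v : Fin n) (σ : Fin n → Bool) : Fin n → Bool :=
  fun u => if adjB g v u then σ u else false

/-- `σ` is a pure Nash equilibrium of the game on graph `g` with tables `ω`:
every player plays a best response to its neighborhood. -/
def isPNE {n : ℕ} (g : GraphSeed n) (ω : Tables n) (σ : Fin n → Bool) : Prop :=
  ∀ v, σ v = ω v (maskG g v σ)

/-- Erdős–Rényi weight of a graph seed: each potential edge is present independently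
with probability `p`. -/
noncomputable def graphWeight {n : ℕ} (p : ℝ) (g : GraphSeed n) : ℝ :=
  ∏ e : EdgePair n, if g e then p else 1 - p

/-- Probability of a table event under the uniform measure on best-response tables. -/
noncomputable def probT (n : ℕ) (A : Tables n → Prop) : ℝ :=
  (∑ ω : Tables n, if A ω then (1 : ℝ) else 0) / (Fintype.card (Tables n) : ℝ)

/-- Joint probability of an event under the random `G(n,p)`-game measure `P_{(n,p)}`:
first draw `g ~ G(n,p)`, then independent uniform best-response tables `ω`. -/
noncomputable def probGT (n : ℕ) (p : ℝ) (A : GraphSeed n → Tables n → Prop) : ℝ :=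
  ∑ g : GraphSeed n, graphWeight p g * probT n (fun ω => A g ω)


def sg {n : ℕ} (v : Fin n) (b : Bool) : Fin n → Bool := fun x => if x = v then b else false

def Good {n : ℕ} (u v : Fin n) (ω : Tables n) : Prop :=
  ∃ a b : Bool, a = ω u (sg v b) ∧ b = ω v (sg u a)

def flipT {n : ℕ} (u v : Fin n) (s t : Bool → Bool) (ω : Tables n) : Tables n :=
  fun w τ => xor (ω w τ) (if w = u then s (τ v) else if w = v then t (τ u) else false)

lemma flipT_flipT {n : ℕ} (u v : Fin n) (s t : Bool → Bool) (ω : Tables n) :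
    flipT u v s t (flipT u v s t ω) = ω := by
  funext w τ
  simp [flipT]

lemma count14 : ∀ A B : Bool → Bool,
    ((univ : Finset ((Bool → Bool) × (Bool → Bool))).filter (fun st =>
      ∃ a b : Bool, a = xor (A b) (st.1 b) ∧ b = xor (B a) (st.2 a))).card = 14 := by
  decide +kernel

lemma good_flip {n : ℕ} {u v : Fin n} (h : u ≠ v) (s t : Bool → Bool) (ω : Tables n) :
    Good u v (flipT u v s t ω) ↔
      ∃ a b : Bool, a = xor (ω u (sg v b)) (s b) ∧ b = xor (ω v (sg u a)) (t a) := by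
  simp [Good, flipT, sg, h.symm]

lemma sum_good {n : ℕ} {u v : Fin n} (h : u ≠ v) (R : Tables n → ℝ)
    (hR : ∀ s t ω, R (flipT u v s t ω) = R ω) :
    ∑ ω : Tables n, (if Good u v ω then (1:ℝ) else 0) * R ω = 7 / 8 * ∑ ω : Tables n, R ω := by
  have h1 : ∀ st : (Bool → Bool) × (Bool → Bool),
      ∑ ω : Tables n, (if Good u v ω then (1:ℝ) else 0) * R ω =
      ∑ ω : Tables n, (if Good u v (flipT u v st.1 st.2 ω) then (1:ℝ) else 0) * R ω := by
    intro st
    have := Equiv.sum_comp (Function.Involutive.toPerm (flipT u v st.1 st.2)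
      (flipT_flipT u v st.1 st.2))
      (fun ω => (if Good u v ω then (1:ℝ) else 0) * R ω)
    rw [← this]
    refine Finset.sum_congr rfl fun ω _ => ?_
    have hp := hR st.1 st.2 ω
    change _ * R (flipT u v st.1 st.2 ω) = _
    rw [hp]
    rfl
  have h2 : ∑ st : (Bool → Bool) × (Bool → Bool),
      ∑ ω : Tables n, (if Good u v (flipT u v st.1 st.2 ω) then (1:ℝ) else 0) * R ω
      = 14 * ∑ ω : Tables n, R ω := by
    rw [Finset.sum_comm, Finset.mul_sum]
    refine Finset.sum_congr rfl fun ω _ => ?_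
    rw [← Finset.sum_mul]
    congr 1
    have := count14 (fun b => ω u (sg v b)) (fun a => ω v (sg u a))
    simp only [good_flip h]
    rw [Finset.sum_boole]
    norm_cast
  rw [← Finset.sum_congr rfl (fun st _ => h1 st)] at h2
  have hc : Fintype.card ((Bool → Bool) × (Bool → Bool)) = 16 := by simp
  rw [Finset.sum_const, Finset.card_univ, hc] at h2
  simp only [nsmul_eq_mul] at h2
  push_cast at h2
  linarith

lemma good_flip_inv {n : ℕ} {u v u' v' : Fin n} (h1 : u' ≠ u) (h2 : u' ≠ v) (h3 : v' ≠ u)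
    (h4 : v' ≠ v) (s t ω) : Good u' v' (flipT u v s t ω) ↔ Good u' v' ω := by
  simp [Good, flipT, h1, h2, h3, h4]

def dj {n : ℕ} (e f : EdgePair n) : Prop :=
  f.1.1 ≠ e.1.1 ∧ f.1.1 ≠ e.1.2 ∧ f.1.2 ≠ e.1.1 ∧ f.1.2 ≠ e.1.2

lemma sum_prod_good {n : ℕ} (S : Finset (EdgePair n))
    (hS : ∀ e ∈ S, ∀ f ∈ S, e ≠ f → dj e f) :
    ∑ ω : Tables n, ∏ e ∈ S, (if Good e.1.1 e.1.2 ω then (1:ℝ) else 0)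
      = (7/8)^S.card * Fintype.card (Tables n) := by
  induction S using Finset.induction_on with
  | empty => simp
  | insert e S he ih =>
    simp only [Finset.prod_insert he]
    rw [sum_good e.2.ne, ih, Finset.card_insert_of_notMem he]
    · ring
    · intro a ha b hb
      exact hS a (mem_insert_of_mem ha) b (mem_insert_of_mem hb)
    · intro s t ω
      refine Finset.prod_congr rfl fun f hf => ?_
      obtain ⟨h1, h2, h3, h4⟩ := hS e (mem_insert_self _ _) f (mem_insert_of_mem hf)
        (fun h => he (h ▸ hf))
      simp only [good_flip_inv h1 h2 h3 h4]

def Mat {n : ℕ} (g : GraphSeed n) : Prop :=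
  ∀ u v w, adjB g u v = true → adjB g u w = true → v = w

lemma adj_lt {n : ℕ} (g : GraphSeed n) (e : EdgePair n) : adjB g e.1.1 e.1.2 = g e := by
  simp [adjB, e.2]

lemma adj_symm {n : ℕ} (g : GraphSeed n) (u v : Fin n) : adjB g u v = adjB g v u := by
  unfold adjB
  rcases lt_trichotomy u v with h | h | h
  · simp [h, h.not_gt]
  · simp [h]
  · simp [h, h.not_gt]

lemma adj_ne {n : ℕ} {g : GraphSeed n} {u v : Fin n} (h : adjB g u v = true) : u ≠ v := by
  rintro rfl
  simp [adjB] at h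

lemma mat_dj {n : ℕ} {g : GraphSeed n} (hg : Mat g) (e f : EdgePair n) (he : g e = true)
    (hf : g f = true) (hne : e ≠ f) : dj e f := by
  have h1 := adj_lt g e
  have h2 := adj_lt g f
  have h3 := adj_symm g e.1.1 e.1.2
  have h4 := adj_symm g f.1.1 f.1.2
  have l1 := e.2
  have l2 := f.2
  obtain ⟨⟨a, b⟩, hab⟩ := e
  obtain ⟨⟨x, y⟩, hxy⟩ := f
  simp only at *
  rw [he] at h1; rw [hf] at h2
  rw [h1] at h3; rw [h2] at h4
  refine ⟨?_, ?_, ?_, ?_⟩ <;> dsimp only <;> rintro rfl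
  · exact hne (by have := hg _ _ _ h1 h2; subst this; rfl)
  · have := hg _ _ _ h3.symm h2
    subst this; exact absurd l1 l2.not_gt
  · have := hg _ _ _ h1 h4.symm
    subst this; exact absurd l1 l2.not_gt
  · exact hne (by have := hg _ _ _ h3.symm h4.symm; subst this; rfl)

lemma mask_sg {n : ℕ} {g : GraphSeed n} (hg : Mat g) {u v : Fin n} (h : adjB g u v = true)
    (σ : Fin n → Bool) : maskG g u σ = sg v (σ v) := by
  funext x
  unfold maskG sg
  by_cases hx : x = v
  · subst hx; simp [h]
  · have : ¬ adjB g u x = true := fun h' => hx (hg _ _ _ h' h)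
    simp [this, hx]

lemma good_symm {n : ℕ} (u v : Fin n) (ω : Tables n) : Good u v ω ↔ Good v u ω := by
  constructor <;> rintro ⟨a, b, h1, h2⟩ <;> exact ⟨b, a, h2, h1⟩

lemma exists_iff {n : ℕ} {g : GraphSeed n} (hg : Mat g) (ω : Tables n) :
    (∃ σ, isPNE g ω σ) ↔ ∀ e : EdgePair n, g e = true → Good e.1.1 e.1.2 ω := by
  constructor
  · rintro ⟨σ, hσ⟩ e he
    have h1 := adj_lt g e
    rw [he] at h1
    have h2 := h1
    rw [adj_symm] at h2
    refine ⟨σ e.1.1, σ e.1.2, ?_, ?_⟩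
    · rw [← mask_sg hg h1]; exact hσ _
    · rw [← mask_sg hg h2]; exact hσ _
  · intro H
    choose! a b hab using H
    let σ : Fin n → Bool := fun w =>
      if h : ∃ e : EdgePair n, g e = true ∧ e.1.1 = w then a h.choose
      else if h : ∃ e : EdgePair n, g e = true ∧ e.1.2 = w then b h.choose
      else ω w (fun _ => false)
    have uniq : ∀ e f : EdgePair n, g e = true → g f = true → ¬ dj e f → f = e := by
      intro e f he hf h
      by_contra h'
      exact h (mat_dj hg e f he hf (Ne.symm h'))
    have s1 : ∀ e : EdgePair n, g e = true → σ e.1.1 = a e := by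
      intro e he
      have h : ∃ e' : EdgePair n, g e' = true ∧ e'.1.1 = e.1.1 := ⟨e, he, rfl⟩
      have : h.choose = e := uniq _ _ he h.choose_spec.1 (by
        intro hd; exact hd.1 h.choose_spec.2)
      simp only [σ, dif_pos h, this]
    have s2 : ∀ e : EdgePair n, g e = true → σ e.1.2 = b e := by
      intro e he
      have h0 : ¬ ∃ e' : EdgePair n, g e' = true ∧ e'.1.1 = e.1.2 := by
        rintro ⟨e', h1, h2⟩
        have := uniq _ _ he h1 (by intro hd; exact hd.2.1 h2)
        subst this
        exact e'.2.ne h2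
      have h : ∃ e' : EdgePair n, g e' = true ∧ e'.1.2 = e.1.2 := ⟨e, he, rfl⟩
      have : h.choose = e := uniq _ _ he h.choose_spec.1 (by
        intro hd; exact hd.2.2.2 h.choose_spec.2)
      simp only [σ, dif_neg h0, dif_pos h, this]
    refine ⟨σ, fun w => ?_⟩
    by_cases h1 : ∃ e : EdgePair n, g e = true ∧ e.1.1 = w
    · obtain ⟨e, he, rfl⟩ := h1
      rw [mask_sg hg ((adj_lt g e).trans he), s1 e he, s2 e he]
      exact (hab e he).1
    · by_cases h2 : ∃ e : EdgePair n, g e = true ∧ e.1.2 = w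
      · obtain ⟨e, he, rfl⟩ := h2
        rw [mask_sg hg ((adj_symm g _ _).trans ((adj_lt g e).trans he)), s1 e he, s2 e he]
        exact (hab e he).2
      · have : maskG g w σ = fun _ => false := by
          funext x
          have : ¬ adjB g w x = true := by
            intro h
            rcases lt_or_gt_of_ne (adj_ne h) with hlt | hlt
            · exact h1 ⟨⟨(w, x), hlt⟩, by rw [← adj_lt g ⟨(w, x), hlt⟩]; exact h, rfl⟩
            · exact h2 ⟨⟨(x, w), hlt⟩, by rw [← adj_lt g ⟨(x, w), hlt⟩, adj_symm]; exact h, rfl⟩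
          simp [maskG, this]
        rw [this]
        simp only [σ, dif_neg h1, dif_neg h2]

lemma probT_mat {n : ℕ} {g : GraphSeed n} (hg : Mat g) :
    probT n (fun ω => ∃ σ, isPNE g ω σ) = (7/8)^(univ.filter (fun e => g e = true)).card := by
  have := sum_prod_good (univ.filter (fun e => g e = true)) (by
    intro e he f hf hne
    exact mat_dj hg e f (by simpa using he) (by simpa using hf) hne)
  unfold probT
  rw [div_eq_iff (by simp), ← this]
  refine Finset.sum_congr rfl fun ω _ => ?_
  rw [Finset.prod_boole]
  simp only [exists_iff hg, Finset.mem_filter, Finset.mem_univ, true_and]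

lemma probT_nonneg (n : ℕ) (A : Tables n → Prop) : 0 ≤ probT n A := by
  unfold probT
  refine div_nonneg (Finset.sum_nonneg fun _ _ => by split_ifs <;> norm_num) (by positivity)

lemma probT_le_one (n : ℕ) (A : Tables n → Prop) : probT n A ≤ 1 := by
  unfold probT
  refine div_le_one_of_le₀ ?_ (by positivity)
  calc _ ≤ ∑ ω : Tables n, (1:ℝ) := Finset.sum_le_sum fun _ _ => by split_ifs <;> norm_num
    _ = _ := by simp

lemma sum_prod_bool {n : ℕ} (φ : EdgePair n → Bool → ℝ) :
    ∑ g : GraphSeed n, ∏ e, φ e (g e) = ∏ e, (φ e true + φ e false) := by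
  have := Finset.prod_univ_sum (fun _ : EdgePair n => (univ : Finset Bool)) φ
  rw [Fintype.piFinset_univ] at this
  rw [← this]
  simp

lemma weight_sum {n : ℕ} (p : ℝ) :
    ∑ g : GraphSeed n, graphWeight p g * (7/8)^(univ.filter (fun e => g e = true)).card
      = (1 - p/8)^(Fintype.card (EdgePair n)) := by
  have := sum_prod_bool (n := n) (fun _ b => (if b then p else 1 - p) * (if b then 7/8 else 1))
  rw [Finset.prod_const] at this
  simp only [Finset.prod_mul_distrib] at this
  convert this using 2
  · congr 1
    rw [Finset.prod_ite]
    simp only [Finset.prod_const, one_pow, mul_one]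
  · simp; ring
  · simp

lemma weight_two {n : ℕ} (p : ℝ) (e f : EdgePair n) (h : e ≠ f) :
    ∑ g : GraphSeed n, graphWeight p g * (if g e = true ∧ g f = true then 1 else 0) = p^2 := by
  have := sum_prod_bool (n := n) (fun x b => (if b then p else 1 - p) *
    (if x ∈ ({e, f} : Finset (EdgePair n)) then (if b = true then 1 else 0) else 1))
  simp only [Finset.prod_mul_distrib] at this
  convert this using 2
  · congr 1
    rw [Finset.prod_ite_mem, Finset.univ_inter, Finset.prod_pair h]
    split_ifs <;> simp_all
  · have : ∀ x : EdgePair n, ((if True then p else 1 - p) *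
      (if x ∈ ({e, f} : Finset (EdgePair n)) then (if True then 1 else 0) else 1) +
      (if false = true then p else 1 - p) *
      (if x ∈ ({e, f} : Finset (EdgePair n)) then (if false = true then 1 else 0) else 1))
      = if x ∈ ({e, f} : Finset (EdgePair n)) then p else 1 := by
      intro x
      by_cases hx : x ∈ ({e, f} : Finset (EdgePair n))
      · simp only [hx, if_true]; simp
      · simp only [hx, if_false]; simp
    rw [Finset.prod_congr rfl fun x _ => this x, Finset.prod_ite_mem, Finset.univ_inter,
      Finset.prod_pair h, sq]

lemma weight_nonneg {n : ℕ} {p : ℝ} (h0 : 0 ≤ p) (h1 : p ≤ 1) (g : GraphSeed n) :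
    0 ≤ graphWeight p g :=
  Finset.prod_nonneg fun e _ => by split_ifs <;> linarith

lemma adj_edge {n : ℕ} {u v : Fin n} (h : u ≠ v) :
    ∃ e : EdgePair n, (∀ g : GraphSeed n, adjB g u v = g e) ∧ s(u, v) = s(e.1.1, e.1.2) := by
  rcases lt_or_gt_of_ne h with h | h
  · exact ⟨⟨(u, v), h⟩, fun g => adj_lt g ⟨(u, v), h⟩, rfl⟩
  · exact ⟨⟨(v, u), h⟩, fun g => by rw [adj_symm]; exact adj_lt g ⟨(v, u), h⟩, Sym2.eq_swap⟩

lemma weight_adj {n : ℕ} (p : ℝ) (u v w : Fin n) (h : v ≠ w) :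
    ∑ g : GraphSeed n, graphWeight p g * (if adjB g u v = true ∧ adjB g u w = true then 1 else 0)
      ≤ p^2 := by
  by_cases huv : u = v
  · subst huv; simp [adjB]; positivity
  by_cases huw : u = w
  · subst huw; simp [adjB]; positivity
  obtain ⟨e, he, he'⟩ := adj_edge huv
  obtain ⟨f, hf, hf'⟩ := adj_edge huw
  have hne : e ≠ f := by
    rintro rfl
    rw [← hf'] at he'
    rw [Sym2.congr_right] at he'
    exact h he'
  simp only [he, hf]
  exact (weight_two p e f hne).le

lemma weight_nonmat {n : ℕ} {p : ℝ} (h0 : 0 ≤ p) (h1 : p ≤ 1) :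
    ∑ g : GraphSeed n, graphWeight p g * (if Mat g then 0 else 1) ≤ n^3 * p^2 := by
  calc _ ≤ ∑ g : GraphSeed n, graphWeight p g * ∑ q : Fin n × Fin n × Fin n,
        (if q.2.1 ≠ q.2.2 then
          (if adjB g q.1 q.2.1 = true ∧ adjB g q.1 q.2.2 = true then (1:ℝ) else 0) else 0) := by
        refine Finset.sum_le_sum fun g _ => mul_le_mul_of_nonneg_left ?_ (weight_nonneg h0 h1 g)
        split_ifs with hg
        · refine Finset.sum_nonneg fun q _ => ?_
          split_ifs <;> norm_num
        · unfold Mat at hg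
          push Not at hg
          obtain ⟨u, v, w, a, b, hne⟩ := hg
          refine le_trans ?_ (Finset.single_le_sum (fun q _ => ?_) (Finset.mem_univ (u, v, w)))
          · simp [a, b, hne]
          · split_ifs <;> norm_num
    _ = ∑ q : Fin n × Fin n × Fin n, ∑ g : GraphSeed n, graphWeight p g *
        (if q.2.1 ≠ q.2.2 then
          (if adjB g q.1 q.2.1 = true ∧ adjB g q.1 q.2.2 = true then (1:ℝ) else 0) else 0) := by
        simp only [Finset.mul_sum]
        rw [Finset.sum_comm]
    _ ≤ ∑ q : Fin n × Fin n × Fin n, p^2 := by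
        refine Finset.sum_le_sum fun q _ => ?_
        by_cases h : q.2.1 = q.2.2
        · simp [h]; positivity
        · simp only [ne_eq, h, not_false_eq_true, if_true]
          exact weight_adj p _ _ _ h
    _ = _ := by
      rw [Finset.sum_const, Finset.card_univ, Fintype.card_prod, Fintype.card_prod, Fintype.card_fin, nsmul_eq_mul]
      push_cast; ring

lemma main_bound {n : ℕ} {p : ℝ} (h0 : 0 ≤ p) (h1 : p ≤ 1) :
    |probGT n p (fun g ω => ∃ σ, isPNE g ω σ) - (1 - p/8)^(Fintype.card (EdgePair n))|
      ≤ n^3 * p^2 := by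
  refine le_trans ?_ (weight_nonmat h0 h1)
  rw [← weight_sum, probGT, ← Finset.sum_sub_distrib]
  refine (Finset.abs_sum_le_sum_abs _ _).trans (Finset.sum_le_sum fun g _ => ?_)
  rw [← mul_sub, abs_mul, abs_of_nonneg (weight_nonneg h0 h1 g)]
  refine mul_le_mul_of_nonneg_left ?_ (weight_nonneg h0 h1 g)
  split_ifs with hg
  · rw [probT_mat hg]; simp
  · have a := probT_nonneg n (fun ω => ∃ σ, isPNE g ω σ)
    have b := probT_le_one n (fun ω => ∃ σ, isPNE g ω σ)
    have c : (0:ℝ) ≤ (7/8)^(univ.filter (fun e => g e = true)).card := by positivity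
    have d : ((7/8:ℝ))^(univ.filter (fun e => g e = true)).card ≤ 1 :=
      pow_le_one₀ (by norm_num) (by norm_num)
    rw [abs_le]; constructor <;> linarith

lemma card_edge (n : ℕ) : Fintype.card (EdgePair n) = n * (n - 1) / 2 := by
  rw [Fintype.card_subtype, Finset.card_filter, Fintype.sum_prod_type, Finset.sum_comm]
  rw [← Finset.sum_range_id, ← Fin.sum_univ_eq_sum_range]
  refine Finset.sum_congr rfl fun v _ => ?_
  rw [← Finset.card_filter]
  rw [← Fin.card_Iio v]
  congr 1
  ext x
  simp

lemma diff_tendsto (c : ℝ) (hc : 0 < c) : Filter.Tendsto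
      (fun n : ℕ =>
        probGT n (c / (n : ℝ) ^ 2) (fun g ω => ∃ σ, isPNE g ω σ) -
          (1 - c / (8 * (n : ℝ) ^ 2)) ^ (n * (n - 1) / 2))
      Filter.atTop (nhds 0) := by
  have hlim : Filter.Tendsto (fun n : ℕ => c^2 / (n:ℝ)) Filter.atTop (nhds 0) :=
    tendsto_const_div_atTop_nhds_zero_nat _
  refine squeeze_zero_norm' ?_ hlim
  filter_upwards [Filter.eventually_ge_atTop (⌈c⌉₊ + 1)] with n hn
  have hn1 : (1:ℝ) ≤ n := by exact_mod_cast (by omega : 1 ≤ n)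
  have hnc : c ≤ n := (Nat.le_ceil c).trans (by exact_mod_cast (by omega))
  have h1 : c / (n:ℝ)^2 ≤ 1 := by
    rw [div_le_one (by positivity)]; nlinarith
  have := main_bound (n := n) (p := c / (n:ℝ)^2) (by positivity) h1
  rw [card_edge] at this
  rw [Real.norm_eq_abs]
  have e1 : c / (8 * (n:ℝ)^2) = c / (n:ℝ)^2 / 8 := by field_simp
  rw [e1]
  refine this.trans (le_of_eq ?_)
  field_simp

lemma pow_lim (c : ℝ) (hc : 0 < c) : Filter.Tendsto
      (fun n : ℕ => (1 - c / (8 * (n : ℝ) ^ 2)) ^ (n * (n - 1) / 2))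
      Filter.atTop (nhds (Real.exp (-c / 16))) := by
  have hN : ∀ n : ℕ, ((n * (n - 1) / 2 : ℕ) : ℝ) = (n:ℝ) * (n - 1) / 2 := by
    intro n
    rw [← Nat.choose_two_right, Nat.cast_choose_two]
  have l1 : Filter.Tendsto (fun n : ℕ => (1:ℝ) / n) Filter.atTop (nhds 0) :=
    tendsto_const_div_atTop_nhds_zero_nat _
  have l2 : Filter.Tendsto (fun n : ℕ => c / (8 * (n:ℝ)^2)) Filter.atTop (nhds 0) := by
    have := (l1.pow 2).const_mul (c/8)
    simp only [ne_eq, OfNat.ofNat_ne_zero, not_false_eq_true, zero_pow, mul_zero] at this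
    refine this.congr fun n => ?_
    ring
  have l3 : Filter.Tendsto (fun n : ℕ => -(c / (8 * (n:ℝ)^2)) * ((n:ℝ) * (n - 1) / 2))
      Filter.atTop (nhds (-c/16)) := by
    have := (l1.const_sub 1).const_mul (-c/16)
    simp only [sub_zero, mul_one] at this
    refine this.congr' ?_
    filter_upwards [Filter.eventually_ge_atTop 1] with n hn
    have : (n:ℝ) ≠ 0 := by exact_mod_cast (by omega : n ≠ 0)
    field_simp
    ring
  have l4 : Filter.Tendsto (fun n : ℕ => -(c / (8 * (n:ℝ)^2)) * ((n:ℝ) * (n - 1) / 2) /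
      (1 - c / (8 * (n:ℝ)^2))) Filter.atTop (nhds (-c/16)) := by
    have := l3.div (l2.const_sub 1) (by norm_num)
    rw [sub_zero, div_one] at this
    exact this
  have hx : ∀ᶠ n : ℕ in Filter.atTop, c / (8 * (n:ℝ)^2) < 1 :=
    l2.eventually_lt_const (by norm_num)
  refine tendsto_of_tendsto_of_tendsto_of_le_of_le'
    ((Real.continuous_exp.tendsto _).comp l4) ((Real.continuous_exp.tendsto _).comp l3) ?_ ?_
  · filter_upwards [hx] with n hn
    set x := c / (8 * (n:ℝ)^2)
    have h1 : 0 < 1 - x := by linarith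
    have h2 : Real.exp (-x / (1 - x)) ≤ 1 - x := by
      have h3 := Real.add_one_le_exp (x / (1 - x))
      have h4 : x / (1 - x) + 1 = (1 - x)⁻¹ := by field_simp; ring
      rw [h4] at h3
      rw [neg_div, Real.exp_neg]
      exact inv_le_of_inv_le₀ h1 h3
    calc _ = Real.exp (-x / (1 - x)) ^ (n * (n - 1) / 2) := by
            rw [← Real.exp_nat_mul, hN]
            simp only [Function.comp]
            congr 1; ring
      _ ≤ _ := pow_le_pow_left₀ (Real.exp_nonneg _) h2 _
  · filter_upwards [hx] with n hn
    set x := c / (8 * (n:ℝ)^2)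
    have h1 : 0 ≤ 1 - x := by linarith
    calc _ ≤ Real.exp (-x) ^ (n * (n - 1) / 2) :=
            pow_le_pow_left₀ h1 (Real.one_sub_le_exp_neg x) _
      _ = _ := by
            rw [← Real.exp_nat_mul, hN]
            simp only [Function.comp]
            congr 1; ring

/-- **Very low connectivity, exact asymptotics.** For `p = c/n²`, the probability that a
random `G(n,p)`-game has a PNE equals `(1 - c/(8n²))^{n(n-1)/2} + o(1)`; in particular
it converges to `e^{-c/16}`. -/
theorem stmt5 (c : ℝ) (hc : 0 < c) :
    Filter.Tendsto
      (fun n : ℕ =>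
        probGT n (c / (n : ℝ) ^ 2) (fun g ω => ∃ σ, isPNE g ω σ) -
          (1 - c / (8 * (n : ℝ) ^ 2)) ^ (n * (n - 1) / 2))
      Filter.atTop (nhds 0) ∧
    Filter.Tendsto
      (fun n : ℕ => probGT n (c / (n : ℝ) ^ 2) (fun g ω => ∃ σ, isPNE g ω σ))
      Filter.atTop (nhds (Real.exp (-c / 16))) := by
  have h1 := diff_tendsto c hc
  refine ⟨h1, ?_⟩
  have := h1.add (pow_lim c hc)
  simpa using this
end

section
/- For a graph G on n labelled vertices, consider a random game on G, let X_σ be the indicator that profile σ is a pure Nash equilibrium, let B_0(G) = { j | ∃ vertex k with j(k') = 0 for all neighbors k' of k }, let B_i(G) = i ⊕ B_0(G), and define b₂(G) = ∑_i ∑_{j ∈ B_i(G), j ≠ i} P[X_i = 1 and X_j = 1], where the sums range over all 2^n strategy profiles and the probability is over the random best-response tables. If G is drawn from the Erdős–Rényi model G(n,p), then E_G[b₂(G)] ≤ S(n,p), where S(n,p) = ∑_{s=1}^{n} C(n,s)·2^{−n}·[ (1+(1−p)^s)^{n−s} − (1−(1−p)^s)^{n−s} ]. -/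
open scoped Classical
open Finset

/-- Expectation of a functional of the random graph under `G(n,p)`. -/
noncomputable def expG (n : ℕ) (p : ℝ) (f : GraphSeed n → ℝ) : ℝ :=
  ∑ g : GraphSeed n, graphWeight p g * f g

/-- The Stein-method quantity
`b₂(G) = ∑_i ∑_{j ∈ B_i(G) \ {i}} P[X_i = 1 ∧ X_j = 1]`, where `B_i(G) = i ⊕ B₀(G)` and
`B₀(G) = {j : ∃ vertex k with j(k') = 0 for all neighbors k' of k}`. -/
noncomputable def b2 (n : ℕ) (g : GraphSeed n) : ℝ :=
  ∑ i : Fin n → Bool, ∑ j : Fin n → Bool,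
    if j ≠ i ∧ ∃ k : Fin n, ∀ k', adjB g k k' = true → xor (j k') (i k') = false then
      probT n (fun ω => isPNE g ω i ∧ isPNE g ω j)
    else 0

/-- `S(n,p) = ∑_{s=1}^n C(n,s) 2^{-n} [(1+(1-p)^s)^{n-s} - (1-(1-p)^s)^{n-s}]`. -/
noncomputable def Sfun (n : ℕ) (p : ℝ) : ℝ :=
  ∑ s ∈ Finset.Icc 1 n,
    (n.choose s : ℝ) / 2 ^ n *
      ((1 + (1 - p) ^ s) ^ (n - s) - (1 - (1 - p) ^ s) ^ (n - s))


/-- The set where two profiles differ. -/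
def diffS {n : ℕ} (i j : Fin n → Bool) : Finset (Fin n) :=
  Finset.univ.filter fun k => j k ≠ i k

/-- Vertex `v` has no neighbor in `D`. -/
def unhit {n : ℕ} (g : GraphSeed n) (D : Finset (Fin n)) (v : Fin n) : Prop :=
  ∀ d ∈ D, adjB g v d = false

lemma count_cyl {ι : Type} [Fintype ι] [DecidableEq ι] (T : Finset ι) (y : ι → Bool) :
    (∑ t : ι → Bool, if (∀ τ ∈ T, t τ = y τ) then (1 : ℝ) else 0)
      = 2 ^ (Fintype.card ι) * (1 / 2) ^ T.card := by
  have h1 : ∀ t : ι → Bool, (if (∀ τ ∈ T, t τ = y τ) then (1 : ℝ) else 0)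
      = ∏ τ : ι, (if τ ∈ T then (if t τ = y τ then (1 : ℝ) else 0) else 1) := by
    intro t
    rw [Finset.prod_ite_mem, Finset.univ_inter, Finset.prod_ite_zero]
    simp
  simp_rw [h1]
  have h2 := Finset.prod_univ_sum (fun _ : ι => (Finset.univ : Finset Bool))
    (fun τ b => (if τ ∈ T then (if b = y τ then (1 : ℝ) else 0) else 1))
  rw [Fintype.piFinset_univ] at h2
  rw [← h2]
  have h3 : ∀ τ : ι, (∑ b : Bool, (if τ ∈ T then (if b = y τ then (1 : ℝ) else 0) else 1))
      = 2 * (if τ ∈ T then (1 / 2 : ℝ) else 1) := by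
    intro τ
    by_cases h : τ ∈ T <;> simp [h]
  simp_rw [h3]
  rw [Finset.prod_mul_distrib, Finset.prod_ite_mem]
  simp

lemma probT_cyl {n : ℕ} (T : Finset (Fin n × (Fin n → Bool)))
    (y : Fin n × (Fin n → Bool) → Bool) :
    probT n (fun ω => ∀ x ∈ T, ω x.1 x.2 = y x) = (1 / 2) ^ T.card := by
  have h0 : probT n (fun ω => ∀ x ∈ T, ω x.1 x.2 = y x) =
      (∑ ω : Tables n, if (∀ x ∈ T, ω x.1 x.2 = y x) then (1 : ℝ) else 0) /
        (Fintype.card (Tables n) : ℝ) := by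
    unfold probT
    congr 1
    apply Finset.sum_congr rfl
    intro ω _
    congr 1
  rw [h0]
  have h : (∑ ω : Tables n, if (∀ x ∈ T, ω x.1 x.2 = y x) then (1 : ℝ) else 0)
      = ∑ t : (Fin n × (Fin n → Bool)) → Bool, if (∀ x ∈ T, t x = y x) then (1 : ℝ) else 0 := by
    apply Fintype.sum_equiv (Equiv.curry (Fin n) (Fin n → Bool) Bool).symm
    intro ω
    rfl
  rw [h, count_cyl]
  have hc : (Fintype.card (Tables n) : ℝ) = 2 ^ Fintype.card (Fin n × (Fin n → Bool)) := by
    rw [← Fintype.card_congr (Equiv.curry (Fin n) (Fin n → Bool) Bool)]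
    simp
  rw [hc]
  field_simp

lemma probT_mono {n : ℕ} {A B : Tables n → Prop} (h : ∀ ω, A ω → B ω) :
    probT n A ≤ probT n B := by
  unfold probT
  gcongr with ω
  by_cases hA : A ω
  · simp [hA, h ω hA]
  · simp only [hA, if_false]
    split_ifs <;> norm_num

lemma mask_eq_unhit {n : ℕ} (g : GraphSeed n) (i j : Fin n → Bool) (v : Fin n) :
    maskG g v i = maskG g v j ↔ unhit g (diffS i j) v := by
  unfold unhit diffS maskG
  rw [funext_iff]
  apply forall_congr'
  intro d
  simp only [Finset.mem_filter, Finset.mem_univ, true_and]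
  cases adjB g v d <;> cases i d <;> cases j d <;> simp

lemma probT_le {n : ℕ} (g : GraphSeed n) (i j : Fin n → Bool) :
    probT n (fun ω => isPNE g ω i ∧ isPNE g ω j) ≤
      ∏ v, (if unhit g (diffS i j) v then (1 / 2 : ℝ) else 1 / 4) := by
  let T : Finset (Fin n × (Fin n → Bool)) :=
    (Finset.univ.sigma fun v => ({maskG g v i, maskG g v j} : Finset (Fin n → Bool))).map
      (Equiv.sigmaEquivProd (Fin n) (Fin n → Bool)).toEmbedding
  have hT : ∀ x, x ∈ T ↔ x.2 = maskG g x.1 i ∨ x.2 = maskG g x.1 j := by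
    rintro ⟨a, b⟩
    simp [T]
  have hc : ((1 / 2 : ℝ)) ^ T.card =
      ∏ v, (if unhit g (diffS i j) v then (1 / 2 : ℝ) else 1 / 4) := by
    simp only [T, Finset.card_map, Finset.card_sigma]
    rw [← Finset.prod_pow_eq_pow_sum]
    apply Finset.prod_congr rfl
    intro v _
    by_cases h : unhit g (diffS i j) v
    · have h' := (mask_eq_unhit g i j v).2 h
      simp [h, h']
    · have h' := fun q => h ((mask_eq_unhit g i j v).1 q)
      rw [Finset.card_pair h', if_neg h]
      norm_num
  rw [← hc, ← probT_cyl T (fun x => if x.2 = maskG g x.1 i then i x.1 else j x.1)]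
  apply probT_mono
  rintro ω ⟨h1, h2⟩ ⟨v, τ⟩ hx
  rw [hT] at hx
  simp only at hx ⊢
  by_cases h : τ = maskG g v i
  · rw [if_pos h, h]; exact (h1 v).symm
  · rw [if_neg h, hx.resolve_left h]; exact (h2 v).symm

lemma probT_zero {n : ℕ} (g : GraphSeed n) (i j : Fin n → Bool) (k : Fin n)
    (hk : k ∈ diffS i j) (hu : unhit g (diffS i j) k) :
    probT n (fun ω => isPNE g ω i ∧ isPNE g ω j) = 0 := by
  unfold probT
  rw [div_eq_zero_iff]
  left
  apply Finset.sum_eq_zero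
  intro ω _
  rw [if_neg]
  rintro ⟨h1, h2⟩
  have h := (mask_eq_unhit g i j k).2 hu
  have a := h1 k
  have b := h2 k
  rw [h, ← b] at a
  simp [diffS, a] at hk

/-- indicator of `unhit` -/
noncomputable def uI {n : ℕ} (g : GraphSeed n) (D : Finset (Fin n)) (v : Fin n) : ℝ :=
  if unhit g D v then 1 else 0

lemma term_le {n : ℕ} (g : GraphSeed n) (i j : Fin n → Bool) :
    (if j ≠ i ∧ ∃ k : Fin n, ∀ k', adjB g k k' = true → xor (j k') (i k') = false then
      probT n (fun ω => isPNE g ω i ∧ isPNE g ω j) else 0) ≤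
    if (diffS i j).card = 0 then 0 else
      (1 / 4) ^ (diffS i j).card *
        ((∏ v ∈ (diffS i j)ᶜ, (uI g (diffS i j) v * (1 / 4) + 1 / 4)) -
          ∏ v ∈ (diffS i j)ᶜ, (uI g (diffS i j) v * (-1 / 4) + 1 / 4)) := by
  set D := diffS i j with hD
  have e1 : (∃ k : Fin n, ∀ k', adjB g k k' = true → xor (j k') (i k') = false) ↔
      ∃ k, unhit g D k := by
    apply exists_congr
    intro k
    unfold unhit
    apply forall_congr'
    intro d
    simp only [hD, diffS, Finset.mem_filter, Finset.mem_univ, true_and]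
    cases adjB g k d <;> cases i d <;> cases j d <;> simp
  have e2 : D.card = 0 ↔ j = i := by
    simp [hD, diffS, Finset.filter_eq_empty_iff, funext_iff]
  by_cases hji : j = i
  · simp [hji, e2]
  have hD0 : ¬ D.card = 0 := fun h => hji (e2.1 h)
  rw [if_neg hD0]
  have hle : ∏ v ∈ Dᶜ, (uI g D v * (-1 / 4) + 1 / 4) ≤ ∏ v ∈ Dᶜ, (uI g D v * (1 / 4) + 1 / 4) := by
    apply Finset.prod_le_prod
    · intro v _; unfold uI; split_ifs <;> norm_num
    · intro v _; unfold uI; split_ifs <;> norm_num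
  have hnn : 0 ≤ (1 / 4 : ℝ) ^ D.card *
        ((∏ v ∈ Dᶜ, (uI g D v * (1 / 4) + 1 / 4)) -
          ∏ v ∈ Dᶜ, (uI g D v * (-1 / 4) + 1 / 4)) :=
    mul_nonneg (by positivity) (sub_nonneg.2 hle)
  by_cases hin : ∃ k ∈ D, unhit g D k
  · obtain ⟨k, hk, hu⟩ := hin
    rw [probT_zero g i j k hk hu]
    simpa using hnn
  push Not at hin
  split_ifs with h
  · rw [e1] at h
    obtain ⟨-, k, hk⟩ := h
    have hkD : k ∈ Dᶜ := by
      rw [Finset.mem_compl]; exact fun h => hin k h hk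
    have hz : ∏ v ∈ Dᶜ, (uI g D v * (-1 / 4) + 1 / 4) = 0 := by
      apply Finset.prod_eq_zero hkD
      simp [uI, hk]
      norm_num
    rw [hz, sub_zero]
    refine (probT_le g i j).trans (le_of_eq ?_)
    rw [← hD, ← Finset.prod_mul_prod_compl D]
    congr 1
    · rw [Finset.prod_congr rfl (g := fun _ => (1 / 4 : ℝ))]
      · simp
      · intro v hv; rw [if_neg (hin v hv)]
    · apply Finset.prod_congr rfl
      intro v _
      unfold uI
      split_ifs <;> norm_num
  · exact hnn

lemma exp_cyl {n : ℕ} (p : ℝ) (M : Finset (EdgePair n)) :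
    expG n p (fun g => if (∀ e ∈ M, g e = false) then 1 else 0) = (1 - p) ^ M.card := by
  unfold expG graphWeight
  have h1 : ∀ g : GraphSeed n, (∏ e : EdgePair n, if g e then p else 1 - p) *
      (if (∀ e ∈ M, g e = false) then (1 : ℝ) else 0)
      = ∏ e : EdgePair n, ((if g e then p else 1 - p) *
          (if e ∈ M then (if g e = false then (1 : ℝ) else 0) else 1)) := by
    intro g
    rw [Finset.prod_mul_distrib]
    congr 1
    rw [Finset.prod_ite_mem, Finset.univ_inter, Finset.prod_ite_zero]
    simp
  simp_rw [h1]
  have h2 := Finset.prod_univ_sum (fun _ : EdgePair n => (Finset.univ : Finset Bool))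
    (fun e b => ((if b then p else 1 - p) *
          (if e ∈ M then (if b = false then (1 : ℝ) else 0) else 1)))
  rw [Fintype.piFinset_univ] at h2
  rw [← h2]
  have h3 : ∀ e : EdgePair n, (∑ b : Bool, ((if b then p else 1 - p) *
          (if e ∈ M then (if b = false then (1 : ℝ) else 0) else 1)))
      = (if e ∈ M then (1 - p : ℝ) else 1) := by
    intro τ
    by_cases h : τ ∈ M <;> simp [h]
  simp_rw [h3]
  rw [Finset.prod_ite_mem]
  simp

/-- the edges between `U` and `D` -/
def cutE {n : ℕ} (U D : Finset (Fin n)) : Finset (EdgePair n) :=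
  Finset.univ.filter fun e => (e.1.1 ∈ U ∧ e.1.2 ∈ D) ∨ (e.1.1 ∈ D ∧ e.1.2 ∈ U)

lemma cut_card {n : ℕ} (U D : Finset (Fin n)) (h : Disjoint U D) :
    (cutE U D).card = U.card * D.card := by
  rw [← Finset.card_product]
  have hd : ∀ a, a ∈ U → a ∈ D → False := fun a h1 h2 => Finset.disjoint_left.1 h h1 h2
  refine Finset.card_bij (fun e _ => if e.1.1 ∈ U then (e.1.1, e.1.2) else (e.1.2, e.1.1)) ?_ ?_ ?_
  · rintro ⟨⟨a, b⟩, hab⟩ he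
    simp only [cutE, Finset.mem_filter, Finset.mem_univ, true_and] at he
    simp only
    split_ifs with hU
    · rcases he with he | he
      · simp [he]
      · exact (hd a hU he.1).elim
    · rcases he with he | he
      · exact (hU he.1).elim
      · simp [he]
  · rintro ⟨⟨a, b⟩, hab⟩ he ⟨⟨a', b'⟩, hab'⟩ he' heq
    simp only at hab hab' heq
    split_ifs at heq <;> simp only [Prod.mk.injEq] at heq
    · simp [heq]
    · obtain ⟨h1, h2⟩ := heq
      subst h1 h2
      exact (lt_asymm hab hab').elim
    · obtain ⟨h1, h2⟩ := heq
      subst h1 h2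
      exact (lt_asymm hab hab').elim
    · simp [heq]
  · rintro ⟨u, d⟩ hud
    rw [Finset.mem_product] at hud
    simp only at hud
    rcases lt_trichotomy u d with hlt | heq | hgt
    · exact ⟨⟨(u, d), hlt⟩, by simp [cutE, hud], by simp [hud]⟩
    · subst heq; exact (hd u hud.1 hud.2).elim
    · have : d ∉ U := fun q => hd d q hud.2
      exact ⟨⟨(d, u), hgt⟩, by simp [cutE, hud], by simp [this]⟩

lemma cut_iff {n : ℕ} (U D : Finset (Fin n)) (g : GraphSeed n) :
    (∀ v ∈ U, unhit g D v) ↔ ∀ e ∈ cutE U D, g e = false := by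
  unfold unhit
  constructor
  · rintro h ⟨⟨a, b⟩, hab⟩ he
    simp only [cutE, Finset.mem_filter, Finset.mem_univ, true_and] at he
    simp only at hab
    rcases he with he | he
    · have := h a he.1 b he.2
      simpa [adjB, hab] using this
    · have := h b he.2 a he.1
      simpa [adjB, hab, not_lt_of_gt hab] using this
  · intro h v hv d hd
    unfold adjB
    split_ifs with h1 h2
    · exact h _ (by simp [cutE, hv, hd])
    · exact h _ (by simp [cutE, hv, hd])
    · rfl

lemma exp_prod {n : ℕ} (p b : ℝ) (D : Finset (Fin n)) :
    expG n p (fun g => ∏ v ∈ Dᶜ, (uI g D v * b + 1 / 4)) =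
      ((1 - p) ^ D.card * b + 1 / 4) ^ (n - D.card) := by
  have h0 : ∀ g : GraphSeed n, ∏ v ∈ Dᶜ, (uI g D v * b + 1 / 4) =
      ∑ U ∈ Dᶜ.powerset, (b ^ U.card * ∏ v ∈ Dᶜ \ U, (1 / 4 : ℝ)) *
        (if (∀ e ∈ cutE U D, g e = false) then 1 else 0) := by
    intro g
    rw [Finset.prod_add]
    apply Finset.sum_congr rfl
    intro U _
    have : ∏ v ∈ U, uI g D v = (if (∀ e ∈ cutE U D, g e = false) then 1 else 0) := by
      unfold uI
      rw [Finset.prod_ite_zero]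
      simp only [cut_iff, Finset.prod_const_one]
    rw [Finset.prod_mul_distrib, this, Finset.prod_const]
    ring
  have h1 : expG n p (fun g => ∏ v ∈ Dᶜ, (uI g D v * b + 1 / 4)) =
      ∑ U ∈ Dᶜ.powerset, (b ^ U.card * ∏ v ∈ Dᶜ \ U, (1 / 4 : ℝ)) *
        expG n p (fun g => if (∀ e ∈ cutE U D, g e = false) then 1 else 0) := by
    unfold expG
    simp_rw [h0, Finset.mul_sum]
    rw [Finset.sum_comm]
    apply Finset.sum_congr rfl
    intro U _
    apply Finset.sum_congr rfl
    intro g _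
    ring
  have h2 : ((1 - p) ^ D.card * b + 1 / 4) ^ (n - D.card) =
      ∏ v ∈ Dᶜ, ((1 - p) ^ D.card * b + 1 / 4) := by
    rw [Finset.prod_const, Finset.card_compl, Fintype.card_fin]
  rw [h1, h2, Finset.prod_add]
  apply Finset.sum_congr rfl
  intro U hU
  rw [Finset.mem_powerset] at hU
  have hdis : Disjoint U D :=
    Finset.disjoint_left.2 fun a ha hD => (Finset.mem_compl.1 (hU ha)) hD
  rw [exp_cyl, cut_card U D hdis, Finset.prod_const, Finset.prod_const, mul_pow, ← pow_mul, mul_comm D.card]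
  ring

/-- contribution of a difference set of size `s` -/
noncomputable def Rf (n : ℕ) (p : ℝ) (s : ℕ) : ℝ :=
  if s = 0 then 0 else (1 / 4) ^ s *
    (((1 - p) ^ s * (1 / 4) + 1 / 4) ^ (n - s) - ((1 - p) ^ s * (-1 / 4) + 1 / 4) ^ (n - s))

lemma graphWeight_nonneg {n : ℕ} (p : ℝ) (hp0 : 0 ≤ p) (hp1 : p ≤ 1) (g : GraphSeed n) :
    0 ≤ graphWeight p g := by
  unfold graphWeight
  apply Finset.prod_nonneg
  intro e _
  split_ifs <;> linarith

lemma sum_diff {n : ℕ} (i : Fin n → Bool) (f : ℕ → ℝ) :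
    ∑ j : Fin n → Bool, f (diffS i j).card = ∑ s ∈ Finset.range (n + 1), (n.choose s) • f s := by
  have h := Finset.sum_powerset_apply_card f (x := (Finset.univ : Finset (Fin n)))
  rw [Finset.card_univ, Fintype.card_fin] at h
  rw [← h]
  refine Finset.sum_bij (fun j _ => diffS i j) ?_ ?_ ?_ ?_
  · intro j _; simp
  · intro j _ j' _ hjj
    funext k
    have := congrArg (fun S => k ∈ S) hjj
    simp only [diffS, Finset.mem_filter, Finset.mem_univ, true_and] at this
    revert this
    cases j k <;> cases j' k <;> cases i k <;> simp
  · intro D _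
    refine ⟨fun k => if k ∈ D then !(i k) else i k, Finset.mem_univ _, ?_⟩
    ext k
    by_cases hk : k ∈ D <;> simp [diffS, hk]
  · intro j _; rfl

/-- **Bounding `E[b₂]`.** For `G ~ G(n,p)`, `E[b₂(G)] ≤ S(n,p)`. -/
theorem stmt15 (n : ℕ) (p : ℝ) (hp0 : 0 ≤ p) (hp1 : p ≤ 1) :
    expG n p (b2 n) ≤ Sfun n p := by
  have h1 : expG n p (b2 n) ≤ ∑ i : Fin n → Bool, ∑ j : Fin n → Bool, Rf n p (diffS i j).card := by
    have : ∑ i : Fin n → Bool, ∑ j : Fin n → Bool, Rf n p (diffS i j).card =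
        expG n p (fun g => ∑ i : Fin n → Bool, ∑ j : Fin n → Bool,
          if (diffS i j).card = 0 then 0 else
      (1 / 4) ^ (diffS i j).card *
        ((∏ v ∈ (diffS i j)ᶜ, (uI g (diffS i j) v * (1 / 4) + 1 / 4)) -
          ∏ v ∈ (diffS i j)ᶜ, (uI g (diffS i j) v * (-1 / 4) + 1 / 4))) := by
      unfold expG
      simp_rw [Finset.mul_sum]
      symm
      rw [Finset.sum_comm]
      apply Finset.sum_congr rfl
      intro i _
      rw [Finset.sum_comm]
      apply Finset.sum_congr rfl
      intro j _
      symm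
      unfold Rf
      split_ifs with h
      · simp
      · rw [← exp_prod, ← exp_prod]
        unfold expG
        rw [← Finset.sum_sub_distrib, Finset.mul_sum]
        apply Finset.sum_congr rfl
        intro g _
        ring
    rw [this]
    unfold expG b2
    apply Finset.sum_le_sum
    intro g _
    apply mul_le_mul_of_nonneg_left _ (graphWeight_nonneg p hp0 hp1 g)
    apply Finset.sum_le_sum
    intro i _
    apply Finset.sum_le_sum
    intro j _
    exact term_le g i j
  refine h1.trans (le_of_eq ?_)
  simp_rw [sum_diff]
  rw [Finset.sum_const, Finset.card_univ]
  have hc : Fintype.card (Fin n → Bool) = 2 ^ n := by simp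
  rw [hc]
  unfold Sfun
  have hr : Finset.range (n + 1) = insert 0 (Finset.Icc 1 n) := by
    ext a; simp; omega
  rw [hr, Finset.sum_insert (by simp)]
  simp only [Rf, if_true, smul_zero, zero_add, nsmul_eq_mul]
  rw [Finset.mul_sum]
  apply Finset.sum_congr rfl
  intro s hs
  rw [Finset.mem_Icc] at hs
  rw [if_neg (by omega)]
  have ea : (1 - p) ^ s * (1 / 4) + 1 / 4 = (1 / 4) * (1 + (1 - p) ^ s) := by ring
  have eb : (1 - p) ^ s * (-1 / 4) + 1 / 4 = (1 / 4) * (1 - (1 - p) ^ s) := by ring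
  rw [ea, eb, mul_pow, mul_pow, ← mul_sub, ← mul_assoc ((1 / 4 : ℝ) ^ s), ← pow_add,
    Nat.add_sub_cancel' hs.2]
  have e4 : (1 / 4 : ℝ) ^ n = (1 / 2 ^ n) * (1 / 2 ^ n) := by
    rw [← one_div_pow, ← mul_pow]; norm_num
  rw [e4]
  push_cast
  field_simp
end
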